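/- Let A ∈ GL(2,ℤ) be an Anosov matrix. If R(A) = ∅, then Aut₀(E_A) = Aut(E_A); if R(A) ≠ ∅, then Aut₀(E_A) is a normal subgroup of index 2 in Aut(E_A), so there is a short exact sequence 1 → Aut₀(E_A) → Aut(E_A) → ℤ/2 → 1. -/

import Mathlib

open Matrix SemidirectProduct Multiplicative

abbrev GL2Z := GL (Fin 2) ℤ

/-- A matrix in `GL(2,ℤ)` is exceptional if `det = 1` and `|tr| ≤ 2`, or `det = -1` and `tr = 0`. -/
def IsExceptional (A : GL2Z) : Prop :=
  ((A : Matrix (Fin 2) (Fin 2) ℤ).det = 1 ∧ |(A : Matrix (Fin 2) (Fin 2) ℤ).trace| ≤ 2) ∨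
    ((A : Matrix (Fin 2) (Fin 2) ℤ).det = -1 ∧ (A : Matrix (Fin 2) (Fin 2) ℤ).trace = 0)

/-- Anosov = not exceptional. -/
def IsAnosov (A : GL2Z) : Prop := ¬ IsExceptional A

/-- The linear action of a 2×2 integer matrix on `ℤ × ℤ`. -/
def mulVec2 (M : Matrix (Fin 2) (Fin 2) ℤ) (p : ℤ × ℤ) : ℤ × ℤ :=
  (M 0 0 * p.1 + M 0 1 * p.2, M 1 0 * p.1 + M 1 1 * p.2)

lemma mulVec2_one (p : ℤ × ℤ) : mulVec2 1 p = p := by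
  simp [mulVec2, Matrix.one_apply]

lemma mulVec2_mul (M N : Matrix (Fin 2) (Fin 2) ℤ) (p : ℤ × ℤ) :
    mulVec2 (M * N) p = mulVec2 M (mulVec2 N p) := by
  apply Prod.ext <;>
    simp only [mulVec2, Matrix.mul_apply, Fin.sum_univ_two] <;> ring

/-- `mulVec2 M` as an additive monoid homomorphism. -/
def mulVec2Hom (M : Matrix (Fin 2) (Fin 2) ℤ) : (ℤ × ℤ) →+ (ℤ × ℤ) where
  toFun := mulVec2 M
  map_zero' := by simp [mulVec2]
  map_add' p q := by
    apply Prod.ext <;> simp only [mulVec2, Prod.fst_add, Prod.snd_add] <;> ring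

/-- The additive automorphism of `ℤ × ℤ` given by an element of `GL(2,ℤ)`. -/
def glAddAut (A : GL2Z) : AddAut (ℤ × ℤ) where
  toFun := mulVec2 (A : Matrix (Fin 2) (Fin 2) ℤ)
  invFun := mulVec2 ((A⁻¹ : GL2Z) : Matrix (Fin 2) (Fin 2) ℤ)
  left_inv p := by
    rw [← mulVec2_mul]
    rw [show ((A⁻¹ : GL2Z) : Matrix (Fin 2) (Fin 2) ℤ) * (A : Matrix (Fin 2) (Fin 2) ℤ) = 1 from
      A.inv_mul]
    exact mulVec2_one p
  right_inv p := by
    rw [← mulVec2_mul]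
    rw [show (A : Matrix (Fin 2) (Fin 2) ℤ) * ((A⁻¹ : GL2Z) : Matrix (Fin 2) (Fin 2) ℤ) = 1 from
      A.mul_inv]
    exact mulVec2_one p
  map_add' := (mulVec2Hom (A : Matrix (Fin 2) (Fin 2) ℤ)).map_add

/-- The multiplicative automorphism of `Multiplicative (ℤ × ℤ)` given by an element of
`GL(2,ℤ)`. -/
def glMulAut (A : GL2Z) : MulAut (Multiplicative (ℤ × ℤ)) :=
  AddEquiv.toMultiplicative (glAddAut A)

/-- The action of `ℤ` on `ℤ × ℤ` in which `1` acts by the matrix `A`. -/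
def EAphi (A : GL2Z) : Multiplicative ℤ →* MulAut (Multiplicative (ℤ × ℤ)) :=
  zpowersHom _ (glMulAut A)

/-- `E_A = (ℤ × ℤ) ⋊ ℤ`, where `1 : ℤ` acts by the matrix `A`. -/
abbrev EA (A : GL2Z) : Type :=
  Multiplicative (ℤ × ℤ) ⋊[EAphi A] Multiplicative ℤ

/-- The canonical subgroup `ℤ × ℤ` of `E_A`. -/
def EAsub (A : GL2Z) : Subgroup (EA A) :=
  (SemidirectProduct.inl : Multiplicative (ℤ × ℤ) →* EA A).range

/-- The subgroup of `Aut(E_A)` of automorphisms mapping the canonical `ℤ × ℤ` onto itself and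
inducing the identity on the quotient `ℤ` (the quotient map being `rightHom`). -/
def Aut₀ (A : GL2Z) : Subgroup (MulAut (EA A)) where
  carrier := {e | (EAsub A).map e.toMonoidHom = EAsub A ∧
    ∀ g : EA A, rightHom (e g) = rightHom g}
  one_mem' := by
    constructor
    · have : ((1 : MulAut (EA A)).toMonoidHom) = MonoidHom.id (EA A) := rfl
      rw [this, Subgroup.map_id]
    · intro g; rfl
  mul_mem' := by
    intro a b ha hb
    constructor
    · have : ((a * b : MulAut (EA A)).toMonoidHom) = a.toMonoidHom.comp b.toMonoidHom := rfl
      rw [this, ← Subgroup.map_map, hb.1, ha.1]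
    · intro g
      have : (a * b : MulAut (EA A)) g = a (b g) := rfl
      rw [this, ha.2, hb.2]
  inv_mem' := by
    intro a ha
    have hcomp : (a⁻¹ : MulAut (EA A)).toMonoidHom.comp a.toMonoidHom = MonoidHom.id (EA A) := by
      refine MonoidHom.ext fun x => ?_
      show (a⁻¹ : MulAut (EA A)) (a x) = x
      simp
    constructor
    · conv_lhs => rw [← ha.1]
      rw [Subgroup.map_map, hcomp, Subgroup.map_id]
    · intro g
      have := ha.2 ((a⁻¹ : MulAut (EA A)) g)
      have h2 : a ((a⁻¹ : MulAut (EA A)) g) = g := by simp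
      rw [h2] at this
      exact this.symm

theorem glMulAut_mul (A B : GL2Z) : glMulAut (A * B) = glMulAut A * glMulAut B :=
  MulEquiv.ext fun v => congrArg ofAdd (mulVec2_mul _ _ v.toAdd)

theorem glMulAut_inv (A : GL2Z) : glMulAut A⁻¹ = (glMulAut A)⁻¹ := rfl

theorem mulVec2_injective : Function.Injective mulVec2 := by
  intro M N h
  have h₁ := congrFun h (1, 0)
  have h₂ := congrFun h (0, 1)
  simp only [mulVec2, Prod.mk.injEq, mul_one, mul_zero, add_zero, zero_add] at h₁ h₂
  ext i j
  fin_cases i <;> fin_cases j <;> simp [h₁, h₂]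

theorem glMulAut_injective : Function.Injective glMulAut := by
  intro A B h
  refine Units.ext (mulVec2_injective (funext fun p => ?_))
  exact congrArg toAdd (DFunLike.congr_fun h (ofAdd p))

theorem EAphi_ofAdd_one (A : GL2Z) : EAphi A (ofAdd 1) = glMulAut A := by
  simp [EAphi]

/-- The matrix of an additive endomorphism of `ℤ × ℤ`. -/
def matrixOfEnd (f : (ℤ × ℤ) →+ (ℤ × ℤ)) : Matrix (Fin 2) (Fin 2) ℤ :=
  !![(f (1, 0)).1, (f (0, 1)).1; (f (1, 0)).2, (f (0, 1)).2]

theorem mulVec2_matrixOfEnd (f : (ℤ × ℤ) →+ (ℤ × ℤ)) (p : ℤ × ℤ) :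
    mulVec2 (matrixOfEnd f) p = f p := by
  have hp : p = p.1 • ((1, 0) : ℤ × ℤ) + p.2 • ((0, 1) : ℤ × ℤ) := by
    ext <;> simp
  conv_rhs => rw [hp, map_add, map_zsmul, map_zsmul]
  ext <;> simp [mulVec2, matrixOfEnd, mul_comm]

theorem glMulAut_surjective : Function.Surjective glMulAut := by
  intro e
  have key : ∀ e₁ e₂ : MulAut (Multiplicative (ℤ × ℤ)), e₁ * e₂ = 1 →
      matrixOfEnd (AddMonoidHom.toMultiplicative.symm e₁.toMonoidHom) *
        matrixOfEnd (AddMonoidHom.toMultiplicative.symm e₂.toMonoidHom) = 1 := by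
    intro e₁ e₂ h
    refine mulVec2_injective (funext fun p => ?_)
    rw [mulVec2_mul, mulVec2_matrixOfEnd, mulVec2_matrixOfEnd, mulVec2_one]
    exact congrArg toAdd (DFunLike.congr_fun h (ofAdd p))
  refine ⟨⟨_, _, key e e⁻¹ (mul_inv_cancel e), key e⁻¹ e (inv_mul_cancel e)⟩, ?_⟩
  refine MulEquiv.ext fun v => ?_
  exact congrArg ofAdd (mulVec2_matrixOfEnd _ v.toAdd)

theorem IsAnosov.det_sub_one_ne_zero {A : GL2Z} (hA : IsAnosov A) :
    ((A : Matrix (Fin 2) (Fin 2) ℤ) - 1).det ≠ 0 := by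
  intro h
  apply hA
  have hdet : (A : Matrix (Fin 2) (Fin 2) ℤ).det = 1 ∨ (A : Matrix (Fin 2) (Fin 2) ℤ).det = -1 :=
    Int.isUnit_iff.1 ((Matrix.isUnit_iff_isUnit_det _).1 A.isUnit)
  have htr : (A : Matrix (Fin 2) (Fin 2) ℤ).trace = (A : Matrix (Fin 2) (Fin 2) ℤ).det + 1 := by
    rw [Matrix.det_fin_two] at h ⊢
    rw [Matrix.trace_fin_two]
    simp at h
    linarith
  rcases hdet with hd | hd
  · exact Or.inl ⟨hd, by rw [htr, hd]; norm_num⟩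
  · exact Or.inr ⟨hd, by rw [htr, hd]; norm_num⟩

theorem mulVec2_mul_adjugate (M : Matrix (Fin 2) (Fin 2) ℤ) (p : ℤ × ℤ) :
    mulVec2 M (mulVec2 M.adjugate p) = M.det • p := by
  rw [← mulVec2_mul, Matrix.mul_adjugate]
  ext <;> simp [mulVec2]

theorem mulVec2_sub_one (M : Matrix (Fin 2) (Fin 2) ℤ) (p : ℤ × ℤ) :
    mulVec2 (M - 1) p = mulVec2 M p - p := by
  ext <;> simp [mulVec2] <;> ring

/-- Every homomorphism from `E_A` to `ℤ` kills the canonical `ℤ × ℤ`. -/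
theorem IsAnosov.map_inl_eq_one {A : GL2Z} (hA : IsAnosov A) (f : EA A →* Multiplicative ℤ)
    (v : Multiplicative (ℤ × ℤ)) : f (inl v) = 1 := by
  have hinv (w : Multiplicative (ℤ × ℤ)) : f (inl (glMulAut A w)) = f (inl w) := by
    rw [← EAphi_ofAdd_one, inl_aut, map_mul, map_mul, mul_right_comm, ← map_mul, ← map_mul]
    simp
  let M : Matrix (Fin 2) (Fin 2) ℤ := A
  let w : ℤ × ℤ := mulVec2 (M - 1).adjugate v.toAdd
  have hw : glMulAut A (ofAdd w) = v ^ (M - 1).det * ofAdd w := by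
    have h : mulVec2 M w - w = (M - 1).det • v.toAdd := by
      rw [← mulVec2_sub_one, mulVec2_mul_adjugate]
    exact congrArg ofAdd (sub_eq_iff_eq_add.1 h)
  have h := hinv (ofAdd w)
  rw [hw, map_mul, map_mul, mul_eq_right, map_zpow, map_zpow] at h
  have h' : (M - 1).det * (f (inl v)).toAdd = 0 := congrArg toAdd h
  exact (mul_eq_zero.1 h').resolve_left hA.det_sub_one_ne_zero

theorem IsAnosov.rightHom_apply {A : GL2Z} (hA : IsAnosov A) (e : MulAut (EA A)) (g : EA A) :
    (rightHom (e g)).toAdd =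
      (rightHom (e (inr (ofAdd 1)))).toAdd * (rightHom g).toAdd := by
  have h : (rightHom.comp e.toMonoidHom) g =
      (rightHom.comp e.toMonoidHom) (inr (ofAdd 1)) ^ (rightHom g).toAdd := by
    conv_lhs => rw [← inl_left_mul_inr_right g]
    rw [map_mul, hA.map_inl_eq_one, one_mul, ← map_zpow, ← map_zpow]
    congr 2
    rw [← ofAdd_zsmul]
    simp
  simpa [mul_comm] using congrArg toAdd h

theorem IsAnosov.map_EAsub {A : GL2Z} (hA : IsAnosov A) (e : MulAut (EA A)) :
    (EAsub A).map e.toMonoidHom = EAsub A := by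
  have hle (e : MulAut (EA A)) (v : Multiplicative (ℤ × ℤ)) : e (inl v) ∈ EAsub A := by
    rw [EAsub, range_inl_eq_ker_rightHom, MonoidHom.mem_ker]
    exact hA.map_inl_eq_one (rightHom.comp e.toMonoidHom) v
  apply le_antisymm
  · rintro _ ⟨_, ⟨v, rfl⟩, rfl⟩
    exact hle e v
  · rintro _ ⟨v, rfl⟩
    exact ⟨e⁻¹ (inl v), hle e⁻¹ v, e.apply_symm_apply _⟩

/-- The sign by which an automorphism of `E_A` acts on the quotient `ℤ`. -/
def quotientSign {A : GL2Z} (hA : IsAnosov A) : MulAut (EA A) →* ℤˣ :=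
  MonoidHom.toHomUnits
    { toFun := fun e => (rightHom (e (inr (ofAdd 1)))).toAdd
      map_one' := rfl
      map_mul' := fun a b => hA.rightHom_apply a (b (inr (ofAdd 1))) }

theorem quotientSign_coe {A : GL2Z} (hA : IsAnosov A) (e : MulAut (EA A)) :
    (quotientSign hA e : ℤ) = (rightHom (e (inr (ofAdd 1)))).toAdd := rfl

theorem ker_quotientSign {A : GL2Z} (hA : IsAnosov A) : (quotientSign hA).ker = Aut₀ A := by
  ext e
  rw [MonoidHom.mem_ker, Units.ext_iff, quotientSign_coe, Units.val_one]
  constructor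
  · intro h
    refine ⟨hA.map_EAsub e, fun g => toAdd.injective ?_⟩
    rw [hA.rightHom_apply, h, one_mul]
  · intro h
    rw [h.2]
    rfl

/-- An automorphism of `E_A` restricts to an automorphism of the canonical `ℤ × ℤ`. -/
theorem IsAnosov.exists_restrict {A : GL2Z} (hA : IsAnosov A) (e : MulAut (EA A)) :
    ∃ F : MulAut (Multiplicative (ℤ × ℤ)), ∀ v, e (inl v) = inl (F v) := by
  have hl (e : MulAut (EA A)) (v : Multiplicative (ℤ × ℤ)) :
      inl (e (inl v)).left = e (inl v) := by
    refine SemidirectProduct.ext rfl ?_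
    exact (hA.map_inl_eq_one (rightHom.comp e.toMonoidHom) v).symm
  refine ⟨{ toFun := fun v => (e (inl v)).left
            invFun := fun v => (e⁻¹ (inl v)).left
            left_inv := fun v => inl_injective (φ := EAphi A) ?_
            right_inv := fun v => inl_injective (φ := EAphi A) ?_
            map_mul' := fun v w => inl_injective (φ := EAphi A) ?_ }, fun v => (hl e v).symm⟩
  · rw [hl, hl]
    exact e.symm_apply_apply _
  · rw [hl, hl]
    exact e.apply_symm_apply _
  · rw [map_mul inl (_ : Multiplicative (ℤ × ℤ)), map_mul inl, map_mul e, hl, hl,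
      ← map_mul e, ← map_mul inl, hl]

theorem conj_eq_inv_of_quotientSign_eq {A : GL2Z} (hA : IsAnosov A) {e : MulAut (EA A)}
    (he : quotientSign hA e = -1) : ∃ B : GL2Z, B * A * B⁻¹ = A⁻¹ := by
  obtain ⟨F, hF⟩ := hA.exists_restrict e
  obtain ⟨B, rfl⟩ := glMulAut_surjective F
  refine ⟨B, ?_⟩
  have hright : (e (inr (ofAdd 1))).right = (ofAdd 1)⁻¹ :=
    toAdd.injective (congrArg Units.val he)
  rw [mul_inv_eq_iff_eq_mul]
  apply glMulAut_injective
  rw [glMulAut_mul, glMulAut_mul, glMulAut_inv]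
  refine MulEquiv.ext fun v => ?_
  have h : (inl (glMulAut A v) : EA A) * inr (ofAdd 1) = inr (ofAdd 1) * inl v := by
    rw [← EAphi_ofAdd_one, inl_aut]
    simp [mul_assoc]
  have h' := congrArg left (congrArg e h)
  rw [map_mul, map_mul, hF, hF, mul_left, mul_left, left_inl, left_inl, right_inl, hright,
    map_inv, map_one, EAphi_ofAdd_one, MulAut.one_apply, mul_comm] at h'
  exact mul_left_cancel h'

theorem exists_quotientSign_eq {A B : GL2Z} (hA : IsAnosov A) (hB : B * A * B⁻¹ = A⁻¹) :
    ∃ e : MulAut (EA A), quotientSign hA e = -1 := by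
  have hsemi : SemiconjBy (glMulAut B) (glMulAut A) (glMulAut A)⁻¹ := by
    rw [SemiconjBy, ← glMulAut_inv, ← glMulAut_mul, ← glMulAut_mul]
    exact congrArg glMulAut (mul_inv_eq_iff_eq_mul.1 hB)
  refine ⟨SemidirectProduct.congr (glMulAut B) (MulEquiv.inv (Multiplicative ℤ)) fun g => ?_,
    Units.ext rfl⟩
  have h := hsemi.zpow_right g.toAdd
  rw [_root_.inv_zpow, ← _root_.zpow_neg] at h
  exact h

/-- Let `A` be Anosov. If `R(A) = ∅` then `Aut₀(E_A) = Aut(E_A)`; if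
`R(A) ≠ ∅` then `Aut₀(E_A)` is a normal subgroup of index 2 of `Aut(E_A)`, i.e. there is a short
exact sequence `1 → Aut₀(E_A) → Aut(E_A) → ℤ/2 → 1`. -/
theorem stmt2 (A : GL2Z) (hA : IsAnosov A) :
    ({B : GL2Z | B * A * B⁻¹ = A⁻¹} = ∅ → Aut₀ A = ⊤) ∧
    ({B : GL2Z | B * A * B⁻¹ = A⁻¹} ≠ ∅ →
      (Aut₀ A).Normal ∧ (Aut₀ A).index = 2) := by
  have hker := ker_quotientSign hA
  refine ⟨fun hR => ?_, fun hR => ?_⟩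
  · rw [← hker, MonoidHom.ker_eq_top_iff]
    refine MonoidHom.ext fun e => (Int.units_eq_one_or _).resolve_right fun he => ?_
    obtain ⟨B, hB⟩ := conj_eq_inv_of_quotientSign_eq hA he
    exact hR.subset hB
  · obtain ⟨B, hB⟩ := Set.nonempty_iff_ne_empty.2 hR
    obtain ⟨e, he⟩ := exists_quotientSign_eq hA hB
    have hsurj : (quotientSign hA).range = ⊤ := by
      rw [MonoidHom.range_eq_top]
      intro u
      rcases Int.units_eq_one_or u with rfl | rfl
      · exact ⟨1, map_one _⟩
      · exact ⟨e, he⟩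
    rw [← hker]
    refine ⟨inferInstance, ?_⟩
    rw [Subgroup.index_ker, hsurj]
    simp
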